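/- Let N_03 be the 4-dimensional ℂ-algebra with basis e_1,e_2,e_3,e_4 and only nonzero basis products e_1e_2 = e_3 and e_2e_1 = −e_3. Each of the eight bilinear forms Δ₁₁, Δ₁₄, Δ₂₁, Δ₂₂, Δ₂₄, Δ₄₁, Δ₄₂, Δ₄₄ is a cocycle on N_03, and their cosets modulo B²(N_03,ℂ) form a basis of H²(N_03,ℂ); in particular dim H²(N_03,ℂ) = 8. -/

import Mathlib

/-- The elementary bilinear multiplication on `ℂ^n` sending `(x, y)` to
`(x_i * y_j) • e_k`; the concrete algebra below is a sum of such terms. -/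
noncomputable def T {n : ℕ} (i j k : Fin n) :
    (Fin n → ℂ) →ₗ[ℂ] (Fin n → ℂ) →ₗ[ℂ] (Fin n → ℂ) :=
  LinearMap.mk₂ ℂ (fun x y => (x i * y j) • (Pi.single k 1 : Fin n → ℂ))
    (fun x x' y => by simp [add_mul, add_smul])
    (fun c x y => by simp [smul_eq_mul, smul_smul, mul_assoc])
    (fun x y y' => by simp [mul_add, add_smul])
    (fun c x y => by simp [smul_eq_mul, smul_smul, mul_left_comm])

/-- The bilinear form `Δ_{ij}` on `ℂ^n` (0-indexed): `Δ_{ij}(x,y) = x_i y_j`,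
so that `Δ_{ij}(e_l, e_m) = δ_{il} δ_{jm}`. -/
noncomputable def D {n : ℕ} (i j : Fin n) :
    (Fin n → ℂ) →ₗ[ℂ] (Fin n → ℂ) →ₗ[ℂ] ℂ :=
  LinearMap.mk₂ ℂ (fun x y => x i * y j)
    (fun x x' y => by simp [add_mul])
    (fun c x y => by simp [mul_assoc])
    (fun x y y' => by simp [mul_add])
    (fun c x y => by simp [smul_eq_mul, mul_left_comm])

/-- The cocycle condition: `θ(xy,z) = θ(xz,y)` and `θ(x,yz) = θ(y,xz)`. -/
def IsCocycle {A V : Type*} [AddCommGroup A] [Module ℂ A] [AddCommGroup V] [Module ℂ V]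
    (m : A →ₗ[ℂ] A →ₗ[ℂ] A) (θ : A →ₗ[ℂ] A →ₗ[ℂ] V) : Prop :=
  (∀ x y z : A, θ (m x y) z = θ (m x z) y) ∧ (∀ x y z : A, θ x (m y z) = θ y (m x z))

/-- `Z²(A,ℂ)`: the space of scalar-valued cocycles. -/
noncomputable def Zsub {A : Type*} [AddCommGroup A] [Module ℂ A]
    (m : A →ₗ[ℂ] A →ₗ[ℂ] A) : Submodule ℂ (A →ₗ[ℂ] A →ₗ[ℂ] ℂ) where
  carrier := {θ | IsCocycle m θ}
  add_mem' := by
    rintro θ η ⟨h1, h2⟩ ⟨g1, g2⟩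
    refine ⟨fun x y z => ?_, fun x y z => ?_⟩
    · simp only [LinearMap.add_apply]
      rw [h1 x y z, g1 x y z]
    · simp only [LinearMap.add_apply]
      rw [h2 x y z, g2 x y z]
  zero_mem' := ⟨fun x y z => by simp, fun x y z => by simp⟩
  smul_mem' := by
    rintro c θ ⟨h1, h2⟩
    refine ⟨fun x y z => ?_, fun x y z => ?_⟩
    · simp only [LinearMap.smul_apply]
      rw [h1 x y z]
    · simp only [LinearMap.smul_apply]
      rw [h2 x y z]

/-- The coboundary map `f ↦ δf = ((x,y) ↦ f(xy))`. -/
noncomputable def cobound {A : Type*} [AddCommGroup A] [Module ℂ A]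
    (m : A →ₗ[ℂ] A →ₗ[ℂ] A) : (A →ₗ[ℂ] ℂ) →ₗ[ℂ] (A →ₗ[ℂ] A →ₗ[ℂ] ℂ) where
  toFun f := m.compr₂ f
  map_add' f g := by ext x y; simp [LinearMap.compr₂_apply]
  map_smul' c f := by ext x y; simp [LinearMap.compr₂_apply]

/-- `B²(A,ℂ)`: the space of scalar-valued coboundaries. -/
noncomputable def Bsub {A : Type*} [AddCommGroup A] [Module ℂ A]
    (m : A →ₗ[ℂ] A →ₗ[ℂ] A) : Submodule ℂ (A →ₗ[ℂ] A →ₗ[ℂ] ℂ) :=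
  LinearMap.range (cobound m)

/-- The coset of a bilinear form modulo `B²(A,ℂ)`. -/
noncomputable def cls {A : Type*} [AddCommGroup A] [Module ℂ A]
    (m : A →ₗ[ℂ] A →ₗ[ℂ] A) (θ : A →ₗ[ℂ] A →ₗ[ℂ] ℂ) :
    (A →ₗ[ℂ] A →ₗ[ℂ] ℂ) ⧸ Bsub m :=
  (Bsub m).mkQ θ

/-- `H²(A,ℂ) = Z²(A,ℂ)/B²(A,ℂ)`, realized as the image of the cocycles in the
quotient of the space of all bilinear forms by the coboundaries. -/
noncomputable def H2 {A : Type*} [AddCommGroup A] [Module ℂ A]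
    (m : A →ₗ[ℂ] A →ₗ[ℂ] A) : Submodule ℂ ((A →ₗ[ℂ] A →ₗ[ℂ] ℂ) ⧸ Bsub m) :=
  (Zsub m).map (Bsub m).mkQ

/-- The algebra `N_03` on `ℂ^4`: `e_1 e_2 = e_3`, `e_2 e_1 = -e_3`. -/
noncomputable def mul : (Fin 4 → ℂ) →ₗ[ℂ] (Fin 4 → ℂ) →ₗ[ℂ] (Fin 4 → ℂ) :=
  T 0 1 2 - T 1 0 2

/-- The forms `Δ₁₁, Δ₁₄, Δ₂₁, Δ₂₂, Δ₂₄, Δ₄₁, Δ₄₂, Δ₄₄` (0-indexed). -/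
noncomputable def forms : Fin 8 → ((Fin 4 → ℂ) →ₗ[ℂ] (Fin 4 → ℂ) →ₗ[ℂ] ℂ) :=
  ![D 0 0, D 0 3, D 1 0, D 1 1, D 1 3, D 3 0, D 3 1, D 3 3]

theorem D_apply {n : ℕ} (i j : Fin n) (x y : Fin n → ℂ) : D i j x y = x i * y j := rfl

theorem mul_eq (x y : Fin 4 → ℂ) :
    mul x y = (x 0 * y 1 - x 1 * y 0) • (Pi.single 2 1 : Fin 4 → ℂ) := by
  simp [mul, T, sub_smul]

theorem cobound_mul_apply (f : (Fin 4 → ℂ) →ₗ[ℂ] ℂ) (x y : Fin 4 → ℂ) :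
    cobound mul f x y = (x 0 * y 1 - x 1 * y 0) * f (Pi.single 2 1) := by
  simp [cobound, mul_eq]

theorem isCocycle_mul_forms (i : Fin 8) : IsCocycle mul (forms i) := by
  constructor <;> intro x y z <;> fin_cases i <;> simp [forms, D_apply, mul_eq]

theorem sum_forms_apply (g : Fin 8 → ℂ) (x y : Fin 4 → ℂ) :
    (∑ i, g i • forms i) x y =
      g 0 * (x 0 * y 0) + g 1 * (x 0 * y 3) + g 2 * (x 1 * y 0) + g 3 * (x 1 * y 1) +
      g 4 * (x 1 * y 3) + g 5 * (x 3 * y 0) + g 6 * (x 3 * y 1) + g 7 * (x 3 * y 3) := by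
  simp [Fin.sum_univ_eight, forms, D_apply]

theorem linearIndependent_cls_forms : LinearIndependent ℂ (fun i => cls mul (forms i)) := by
  rw [Fintype.linearIndependent_iff]
  intro g hg
  have hB : ∑ i, g i • forms i ∈ Bsub mul := by
    rw [← Submodule.Quotient.mk_eq_zero, ← Submodule.mkQ_apply, map_sum]
    simpa only [map_smul, cls] using hg
  obtain ⟨f, hf⟩ := hB
  have key (k l : Fin 4) := LinearMap.congr_fun₂ hf (Pi.single k 1) (Pi.single l 1)
  simp only [cobound_mul_apply, sum_forms_apply] at key
  have h12 : f (Pi.single 2 1) = 0 := by simpa using key 0 1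
  simp only [h12, mul_zero] at key
  intro i
  fin_cases i
  · simpa using (key 0 0).symm
  · simpa using (key 0 3).symm
  · simpa using (key 1 0).symm
  · simpa using (key 1 1).symm
  · simpa using (key 1 3).symm
  · simpa using (key 3 0).symm
  · simpa using (key 3 1).symm
  · simpa using (key 3 3).symm

/-- A cocycle on `N_03` is a combination of the listed forms plus a coboundary. -/
theorem IsCocycle.eq_sum_forms_add_cobound {θ : (Fin 4 → ℂ) →ₗ[ℂ] (Fin 4 → ℂ) →ₗ[ℂ] ℂ}
    (h : IsCocycle mul θ) :
    ∃ (g : Fin 8 → ℂ) (f : (Fin 4 → ℂ) →ₗ[ℂ] ℂ), θ = ∑ i, g i • forms i + cobound mul f := by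
  obtain ⟨hl, hr⟩ := h
  let e (k : Fin 4) : Fin 4 → ℂ := Pi.single k 1
  have h20 : θ (e 2) (e 0) = 0 := by simpa [mul_eq, e] using hl (e 0) (e 1) (e 0)
  have h21 : θ (e 2) (e 1) = 0 := by simpa [mul_eq, e] using hl (e 1) (e 0) (e 1)
  have h22 : θ (e 2) (e 2) = 0 := by simpa [mul_eq, e] using hl (e 0) (e 1) (e 2)
  have h23 : θ (e 2) (e 3) = 0 := by simpa [mul_eq, e] using hl (e 0) (e 1) (e 3)
  have h02 : θ (e 0) (e 2) = 0 := by simpa [mul_eq, e] using hr (e 0) (e 1) (e 0)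
  have h12 : θ (e 1) (e 2) = 0 := by simpa [mul_eq, e] using hr (e 1) (e 0) (e 1)
  have h32 : θ (e 3) (e 2) = 0 := by simpa [mul_eq, e] using hr (e 3) (e 0) (e 1)
  refine ⟨![θ (e 0) (e 0), θ (e 0) (e 3), θ (e 1) (e 0) + θ (e 0) (e 1), θ (e 1) (e 1),
    θ (e 1) (e 3), θ (e 3) (e 0), θ (e 3) (e 1), θ (e 3) (e 3)],
    θ (e 0) (e 1) • LinearMap.proj 2, ?_⟩
  refine LinearMap.ext_basis (Pi.basisFun ℂ (Fin 4)) (Pi.basisFun ℂ (Fin 4)) fun k l => ?_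
  simp only [Pi.basisFun_apply, LinearMap.add_apply, sum_forms_apply, cobound_mul_apply]
  change θ (e k) (e l) = _
  fin_cases k <;> fin_cases l <;> simp [h20, h21, h22, h23, h02, h12, h32]

theorem span_cls_forms :
    Submodule.span ℂ (Set.range fun i => cls mul (forms i)) = H2 mul := by
  apply le_antisymm
  · rw [Submodule.span_le]
    rintro _ ⟨i, rfl⟩
    exact Submodule.mem_map_of_mem (isCocycle_mul_forms i)
  · rintro _ ⟨θ, hθ, rfl⟩
    obtain ⟨g, f, rfl⟩ := IsCocycle.eq_sum_forms_add_cobound hθ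
    have hf : (Bsub mul).mkQ (cobound mul f) = 0 :=
      (Submodule.Quotient.mk_eq_zero _).2 ⟨f, rfl⟩
    rw [map_add, hf, add_zero, map_sum]
    refine Submodule.sum_mem _ fun i _ => ?_
    rw [map_smul]
    exact Submodule.smul_mem _ _ (Submodule.subset_span ⟨i, rfl⟩)

/-- The listed forms are cocycles, their cosets modulo `B²` form a basis of `H²`,
and in particular `dim H² = 8`. -/
theorem secondCohomology_N03 :
    (∀ i, IsCocycle mul (forms i)) ∧
    LinearIndependent ℂ (fun i => cls mul (forms i)) ∧
    Submodule.span ℂ (Set.range fun i => cls mul (forms i)) = H2 mul ∧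
    Module.finrank ℂ (H2 mul) = 8 := by
  refine ⟨isCocycle_mul_forms, linearIndependent_cls_forms, span_cls_forms, ?_⟩
  rw [← span_cls_forms, finrank_span_eq_card linearIndependent_cls_forms, Fintype.card_fin]
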